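/- arXiv:1008.2138 — 2 statements merged into one kernel-verified Lean document; each statement's English description precedes it below -/
import Mathlib

section
/- (Hessian coefficient error for BQCE.) Let γ : ℤ → [0,1] be N-periodic with α_ξ := (γ_ξ + γ_{ξ−1})/2 and β_ξ := 1 − (γ_{ξ+1} + γ_{ξ−1})/2, let y ∈ 𝒴 with min_ξ y'_ξ > 0, and set C̄_i := C_i(2 min_ξ y'_ξ). Then max_ξ |Ā_ξ − A_ξ| ≤ 2C̄₂ max_ξ |Δ²α_ξ| + 2εC̄₃ max_ξ |Δβ_ξ · y''_ξ| + 2ε² ( C̄₃ max_ξ |(1−β_{ξ−1}) y'''_ξ| + C̄₄ max_ξ |(1−β_ξ)(y''_ξ)²| ). -/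
open scoped BigOperators ENNReal
open Finset

noncomputable section

/-- The lattice spacing `ε = 1/N`. -/
def eps (N : ℕ) : ℝ := (N : ℝ)⁻¹

/-- `u : ℤ → ℝ` is `N`-periodic. -/
def IsPeriodic (N : ℕ) (u : ℤ → ℝ) : Prop := ∀ ξ : ℤ, u (ξ + N) = u ξ

/-- Membership in the space `𝒰` of `N`-periodic mean-zero displacements. -/
def inU (N : ℕ) (u : ℤ → ℝ) : Prop :=
  IsPeriodic N u ∧ ∑ ξ ∈ Finset.Icc (1 : ℤ) (N : ℤ), u ξ = 0

/-- The uniform deformation `y^F_ξ = F ε ξ`. -/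
def yUnif (N : ℕ) (F : ℝ) : ℤ → ℝ := fun ξ => F * eps N * ξ

/-- Membership in the space `𝒴` of admissible deformations. -/
def inY (N : ℕ) (y : ℤ → ℝ) : Prop :=
  ∃ F : ℝ, 0 < F ∧ ∃ u : ℤ → ℝ, inU N u ∧ y = fun ξ => yUnif N F ξ + u ξ

/-- The discrete first derivative `y'_ξ = (y_ξ - y_{ξ-1})/ε`. -/
def d1 (N : ℕ) (y : ℤ → ℝ) (ξ : ℤ) : ℝ := (y ξ - y (ξ - 1)) / eps N

/-- The discrete second derivative `y''_ξ`. -/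
def d2 (N : ℕ) (y : ℤ → ℝ) (ξ : ℤ) : ℝ :=
  (y (ξ + 1) - 2 * y ξ + y (ξ - 1)) / (eps N) ^ 2

/-- The discrete third derivative `y'''_ξ`. -/
def d3 (N : ℕ) (y : ℤ → ℝ) (ξ : ℤ) : ℝ :=
  (y (ξ + 1) - 3 * y ξ + 3 * y (ξ - 1) - y (ξ - 2)) / (eps N) ^ 3

/-- The BQC energy `Φ_{α,β}`. -/
def PhiBQC (N : ℕ) (φ : ℝ → ℝ) (α β : ℤ → ℝ) (y : ℤ → ℝ) : ℝ :=
  eps N * ∑ ξ ∈ Finset.Icc (1 : ℤ) (N : ℤ),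
    (φ (d1 N y ξ) + α ξ * φ (2 * d1 N y ξ) + β ξ * φ (d1 N y ξ + d1 N y (ξ + 1)))

/-- The BQNL energy with blending function `η`. -/
def PhiBQNL (N : ℕ) (φ : ℝ → ℝ) (η : ℤ → ℝ) : (ℤ → ℝ) → ℝ :=
  PhiBQC N φ (fun ξ => 1 - (η ξ + η (ξ - 1)) / 2) η

/-- The BQCE energy with blending function `γ`. -/
def PhiBQCE (N : ℕ) (φ : ℝ → ℝ) (γ : ℤ → ℝ) : (ℤ → ℝ) → ℝ :=
  PhiBQC N φ (fun ξ => (γ ξ + γ (ξ - 1)) / 2) (fun ξ => 1 - (γ (ξ + 1) + γ (ξ - 1)) / 2)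

/-- The atomistic energy `Φ`. -/
def PhiAt (N : ℕ) (φ : ℝ → ℝ) (y : ℤ → ℝ) : ℝ :=
  eps N * ∑ ξ ∈ Finset.Icc (1 : ℤ) (N : ℤ),
    (φ (d1 N y ξ) + φ (d1 N y ξ + d1 N y (ξ + 1)))

/-- The first variation `δΨ(y)[u] = (d/dt)|_{t=0} Ψ(y+tu)`. -/
def fvar (Ψ : (ℤ → ℝ) → ℝ) (y u : ℤ → ℝ) : ℝ :=
  deriv (fun t : ℝ => Ψ (fun ξ => y ξ + t * u ξ)) 0

/-- The second variation `δ²Ψ(y)[u,u] = (d²/dt²)|_{t=0} Ψ(y+tu)`. -/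
def svar (Ψ : (ℤ → ℝ) → ℝ) (y u : ℤ → ℝ) : ℝ :=
  iteratedDeriv 2 (fun t : ℝ => Ψ (fun ξ => y ξ + t * u ξ)) 0

/-- `max_ξ |v_ξ|` (for a periodic sequence this is a genuine maximum). -/
def supAbs (v : ℤ → ℝ) : ℝ := sSup (Set.range fun ξ => |v ξ|)

/-- `min_ξ y'_ξ` (for an admissible deformation this is a genuine minimum). -/
def infD1 (N : ℕ) (y : ℤ → ℝ) : ℝ := sInf (Set.range fun ξ => d1 N y ξ)

/-- The constant `C_i(r₀) = sup_{r ≥ r₀} |φ^(i)(r)|`. -/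
def Cbound (φ : ℝ → ℝ) (i : ℕ) (r₀ : ℝ) : ℝ :=
  sSup ((fun r => |iteratedDeriv i φ r|) '' Set.Ici r₀)

/-- The `ℓ^p_ε` norm over one period, `p ∈ [1,∞]`. -/
def lpnorm (N : ℕ) (p : ℝ≥0∞) (v : ℤ → ℝ) : ℝ :=
  if p = ⊤ then supAbs v
  else (eps N * ∑ ξ ∈ Finset.Icc (1 : ℤ) (N : ℤ), |v ξ| ^ p.toReal) ^ (1 / p.toReal)

/-- The Hessian coefficient `A_ξ` of the atomistic energy. -/
def Acoef (N : ℕ) (φ : ℝ → ℝ) (y : ℤ → ℝ) (ξ : ℤ) : ℝ :=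
  iteratedDeriv 2 φ (d1 N y ξ) + 2 * iteratedDeriv 2 φ (d1 N y ξ + d1 N y (ξ + 1))
    + 2 * iteratedDeriv 2 φ (d1 N y (ξ - 1) + d1 N y ξ)

/-- The Hessian coefficient `Ā_ξ` of the BQC energy. -/
def AbarCoef (N : ℕ) (φ : ℝ → ℝ) (α β : ℤ → ℝ) (y : ℤ → ℝ) (ξ : ℤ) : ℝ :=
  iteratedDeriv 2 φ (d1 N y ξ) + 2 * β ξ * iteratedDeriv 2 φ (d1 N y ξ + d1 N y (ξ + 1))
    + 2 * β (ξ - 1) * iteratedDeriv 2 φ (d1 N y (ξ - 1) + d1 N y ξ)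
    + 4 * α ξ * iteratedDeriv 2 φ (2 * d1 N y ξ)

/-- The coercivity constant `inf { δ²Ψ(y)[u,u] : u ∈ 𝒰, ‖u'‖_{ℓ²_ε} = 1 }`. -/
def coercConst (N : ℕ) (Ψ : (ℤ → ℝ) → ℝ) (y : ℤ → ℝ) : ℝ :=
  sInf { c : ℝ | ∃ u : ℤ → ℝ, inU N u ∧ lpnorm N 2 (d1 N u) = 1 ∧ c = svar Ψ y u }

end

theorem IsPeriodic.abs_le_supAbs {N : ℕ} (hN : 0 < N) {v : ℤ → ℝ} (hv : IsPeriodic N v) (ξ : ℤ) :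
    |v ξ| ≤ supAbs v := by
  have hbdd : BddAbove (Set.range fun ξ => |v ξ|) := by
    refine (((Finset.Ico (0 : ℤ) N).finite_toSet.image fun ξ => |v ξ|).bddAbove).mono ?_
    rintro _ ⟨ξ, rfl⟩
    have hN' : (N : ℤ) ≠ 0 := by exact_mod_cast hN.ne'
    refine ⟨ξ % N, ?_, ?_⟩
    · simpa using ⟨Int.emod_nonneg _ hN', Int.emod_lt_of_pos _ (by exact_mod_cast hN)⟩
    · have h : v (ξ - (ξ / N) • (N : ℤ)) = v ξ :=
        Function.Periodic.sub_zsmul_eq (c := (N : ℤ)) hv (ξ / N)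
      have h' : ξ % N = ξ - (ξ / N) • (N : ℤ) := by
        rw [Int.emod_def, smul_eq_mul, mul_comm]
      simp only [h', h]
  exact le_csSup hbdd ⟨ξ, rfl⟩

theorem inY.exists_add_period {N : ℕ} (hN : 0 < N) {y : ℤ → ℝ} (hy : inY N y) :
    ∃ F : ℝ, ∀ ξ, y (ξ + N) = y ξ + F := by
  obtain ⟨F, -, u, ⟨hu, -⟩, rfl⟩ := hy
  refine ⟨F, fun ξ => ?_⟩
  have hN' : (N : ℝ) ≠ 0 := by exact_mod_cast hN.ne'
  simp only [yUnif, eps, hu ξ]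
  push_cast
  field_simp
  ring

theorem inY.d2_periodic {N : ℕ} (hN : 0 < N) {y : ℤ → ℝ} (hy : inY N y) :
    IsPeriodic N (d2 N y) := by
  obtain ⟨F, hF⟩ := hy.exists_add_period hN
  intro ξ
  simp only [d2, add_right_comm ξ (N : ℤ) 1, add_sub_right_comm ξ (N : ℤ), hF]
  ring

theorem inY.d3_periodic {N : ℕ} (hN : 0 < N) {y : ℤ → ℝ} (hy : inY N y) :
    IsPeriodic N (d3 N y) := by
  obtain ⟨F, hF⟩ := hy.exists_add_period hN
  intro ξ
  simp only [d3, add_right_comm ξ (N : ℤ) 1, add_sub_right_comm ξ (N : ℤ), hF]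
  ring

theorem infD1_le_d1 {N : ℕ} {y : ℤ → ℝ} (h : 0 < infD1 N y) (ξ : ℤ) : infD1 N y ≤ d1 N y ξ := by
  refine csInf_le ?_ ⟨ξ, rfl⟩
  by_contra hb
  exact h.ne' (Real.sInf_of_not_bddBelow hb)

theorem eps_mul_d2 {N : ℕ} (hN : 0 < N) (y : ℤ → ℝ) (ξ : ℤ) :
    eps N * d2 N y ξ = d1 N y (ξ + 1) - d1 N y ξ := by
  have hN' : (N : ℝ) ≠ 0 := by exact_mod_cast hN.ne'
  simp only [d1, d2, eps, add_sub_cancel_right]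
  field_simp
  ring

theorem eps_mul_d3 {N : ℕ} (hN : 0 < N) (y : ℤ → ℝ) (ξ : ℤ) :
    eps N * d3 N y ξ = d2 N y ξ - d2 N y (ξ - 1) := by
  have hN' : (N : ℝ) ≠ 0 := by exact_mod_cast hN.ne'
  simp only [d2, d3, eps, sub_add_cancel, sub_sub, one_add_one_eq_two]
  field_simp
  ring

theorem ContDiffOn.hasDerivAt_iteratedDeriv {f : ℝ → ℝ} {s : Set ℝ} {n m : ℕ}
    (hf : ContDiffOn ℝ n f s) (hs : IsOpen s) (hm : m < n) {x : ℝ} (hx : x ∈ s) :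
    HasDerivAt (iteratedDeriv m f) (iteratedDeriv (m + 1) f x) x := by
  rw [iteratedDeriv_succ]
  refine DifferentiableAt.hasDerivAt ?_
  have h := hf.differentiableOn_iteratedDerivWithin (m := m) (by exact_mod_cast hm)
    hs.uniqueDiffOn
  exact ((h.congr fun z hz => (iteratedDerivWithin_of_isOpen hs hz).symm).differentiableAt
    (hs.mem_nhds hx))

/-- Second-order Taylor estimate on a convex set, for increments of either sign. -/
theorem Convex.abs_taylor_two_le {s : Set ℝ} (hs : Convex ℝ s) {f f' f'' : ℝ → ℝ} {C : ℝ}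
    (hf : ∀ x ∈ s, HasDerivAt f (f' x) x) (hf' : ∀ x ∈ s, HasDerivAt f' (f'' x) x)
    (hC : ∀ x ∈ s, |f'' x| ≤ C) {x h : ℝ} (hx : x ∈ s) (hxh : x + h ∈ s) :
    |f (x + h) - f x - f' x * h| ≤ C * h ^ 2 / 2 := by
  have hmem : ∀ t ∈ Set.Icc (0 : ℝ) 1, x + t * h ∈ s := fun t ht => by
    simpa using hs.add_smul_mem hx hxh ht
  have hg : ∀ t ∈ Set.Icc (0 : ℝ) 1,
      HasDerivAt (fun t => f (x + t * h) - f x - f' x * (t * h))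
        ((f' (x + t * h) - f' x) * h) t := by
    intro t ht
    have hlin : HasDerivAt (fun t : ℝ => t * h) h t := by
      simpa using (hasDerivAt_id t).mul_const h
    have := (((hf _ (hmem t ht)).comp t (hlin.const_add x)).sub_const (f x)).sub
      (hlin.const_mul (f' x))
    exact this.congr_deriv (by ring)
  have hB : ∀ t : ℝ, HasDerivAt (fun t => C * h ^ 2 / 2 * t ^ 2) (C * h ^ 2 * t) t := fun t =>
    ((hasDerivAt_pow 2 t).const_mul (C * h ^ 2 / 2)).congr_deriv (by push_cast; ring)
  have key := image_norm_le_of_norm_deriv_right_le_deriv_boundary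
    (fun t ht => (hg t ht).continuousAt.continuousWithinAt)
    (fun t ht => (hg t (Set.Ico_subset_Icc_self ht)).hasDerivWithinAt) (by simp) hB
    (fun t ht => ?_) (Set.right_mem_Icc.2 zero_le_one)
  · simpa using key
  · have hm := hs.norm_image_sub_le_of_norm_hasDerivWithin_le
      (fun z hz => (hf' z hz).hasDerivWithinAt) hC hx (hmem t (Set.Ico_subset_Icc_self ht))
    rw [add_sub_cancel_left, Real.norm_eq_abs, Real.norm_eq_abs, abs_mul, abs_of_nonneg ht.1] at hm
    rw [Real.norm_eq_abs, abs_mul, ← sq_abs h]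
    nlinarith [mul_le_mul_of_nonneg_right hm (abs_nonneg h)]

/-- Hessian coefficient error for BQCE. -/
theorem hessian_coef_error_bqce
    (N : ℕ) (hN : 5 ≤ N) (φ : ℝ → ℝ) (hφ : ContDiffOn ℝ 4 φ (Set.Ioi 0))
    (hC : ∀ i ≤ 4, ∀ r₀ : ℝ, 0 < r₀ →
      BddAbove ((fun r => |iteratedDeriv i φ r|) '' Set.Ici r₀))
    (γ : ℤ → ℝ) (hγper : IsPeriodic N γ) (hγ01 : ∀ ξ, γ ξ ∈ Set.Icc (0 : ℝ) 1)
    (α β : ℤ → ℝ) (hα : α = fun ξ => (γ ξ + γ (ξ - 1)) / 2)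
    (hβ : β = fun ξ => 1 - (γ (ξ + 1) + γ (ξ - 1)) / 2)
    (y : ℤ → ℝ) (hy : inY N y) (hy' : 0 < infD1 N y) :
    supAbs (fun ξ => AbarCoef N φ α β y ξ - Acoef N φ y ξ) ≤
      2 * Cbound φ 2 (2 * infD1 N y) * supAbs (fun ξ => α (ξ + 1) - 2 * α ξ + α (ξ - 1))
        + 2 * eps N * Cbound φ 3 (2 * infD1 N y) *
            supAbs (fun ξ => (β ξ - β (ξ - 1)) * d2 N y ξ)
        + 2 * (eps N) ^ 2 *
            (Cbound φ 3 (2 * infD1 N y) * supAbs (fun ξ => (1 - β (ξ - 1)) * d3 N y ξ)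
              + Cbound φ 4 (2 * infD1 N y) *
                  supAbs (fun ξ => (1 - β ξ) * (d2 N y ξ) ^ 2)) := by
  have hN0 : 0 < N := by omega
  set m := infD1 N y
  have hε : 0 < eps N := inv_pos.2 (by exact_mod_cast hN0)
  have hCle : ∀ i ≤ 4, ∀ r : ℝ, r ∈ Set.Ici (2 * m) → |iteratedDeriv i φ r| ≤ Cbound φ i (2 * m) :=
    fun i hi r hr => le_csSup (hC i hi _ (mul_pos two_pos hy')) ⟨r, hr, rfl⟩
  have hpos : ∀ r ∈ Set.Ici (2 * m), r ∈ Set.Ioi (0 : ℝ) := fun r hr =>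
    (mul_pos two_pos hy').trans_le hr
  have htaylor : ∀ x h : ℝ, 2 * m ≤ x → 2 * m ≤ x + h →
      |iteratedDeriv 2 φ (x + h) - iteratedDeriv 2 φ x - iteratedDeriv 3 φ x * h|
        ≤ Cbound φ 4 (2 * m) * h ^ 2 / 2 := fun x h hx hxh =>
    (convex_Ici (2 * m)).abs_taylor_two_le
      (fun r hr => ContDiffOn.hasDerivAt_iteratedDeriv (n := 4) hφ isOpen_Ioi (by norm_num)
        (hpos r hr))
      (fun r hr => ContDiffOn.hasDerivAt_iteratedDeriv (n := 4) hφ isOpen_Ioi (by norm_num)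
        (hpos r hr))
      (hCle 4 le_rfl) hx hxh
  have hγsub : ∀ ξ k : ℤ, γ (ξ + N - k) = γ (ξ - k) := fun ξ k => by
    rw [add_sub_right_comm, hγper]
  have hγadd : ∀ ξ k : ℤ, γ (ξ + N + k) = γ (ξ + k) := fun ξ k => by
    rw [add_right_comm, hγper]
  have hαper : IsPeriodic N α := fun ξ => by simp only [hα, hγsub, hγper ξ]
  have hβper : IsPeriodic N β := fun ξ => by simp only [hβ, hγsub, hγadd]
  have hβ1 : ∀ ξ, 0 ≤ 1 - β ξ := fun ξ => by
    simp only [hβ]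
    linarith [(hγ01 (ξ + 1)).1, (hγ01 (ξ - 1)).1]
  have hd2per := hy.d2_periodic hN0
  have hd3per := hy.d3_periodic hN0
  have hshift : ∀ {v : ℤ → ℝ}, IsPeriodic N v → ∀ ξ, v (ξ + N - 1) = v (ξ - 1) := fun hv ξ => by
    rw [add_sub_right_comm, hv]
  have hS1 := IsPeriodic.abs_le_supAbs hN0
    (v := fun ξ => α (ξ + 1) - 2 * α ξ + α (ξ - 1)) (fun ξ => by
      simp only [hshift hαper, hαper ξ, add_right_comm ξ (N : ℤ) 1, hαper (ξ + 1)])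
  have hS2 := IsPeriodic.abs_le_supAbs hN0
    (v := fun ξ => (β ξ - β (ξ - 1)) * d2 N y ξ) (fun ξ => by
      simp only [hshift hβper, hβper ξ, hd2per ξ])
  have hS3 := IsPeriodic.abs_le_supAbs hN0
    (v := fun ξ => (1 - β (ξ - 1)) * d3 N y ξ) (fun ξ => by
      simp only [hshift hβper, hd3per ξ])
  have hS4 := IsPeriodic.abs_le_supAbs hN0
    (v := fun ξ => (1 - β ξ) * (d2 N y ξ) ^ 2) (fun ξ => by
      simp only [hβper ξ, hd2per ξ])
  refine csSup_le (Set.range_nonempty _) ?_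
  rintro _ ⟨ξ, rfl⟩
  have hx : 2 * m ≤ 2 * d1 N y ξ := by linarith [infD1_le_d1 hy' ξ]
  have e1 := eps_mul_d2 hN0 y ξ
  have e2 := eps_mul_d2 hN0 y (ξ - 1)
  have e3 := eps_mul_d3 hN0 y ξ
  rw [sub_add_cancel] at e2
  have a1 : d1 N y ξ + d1 N y (ξ + 1) = 2 * d1 N y ξ + eps N * d2 N y ξ := by linarith
  have a2 : d1 N y (ξ - 1) + d1 N y ξ = 2 * d1 N y ξ + -(eps N * d2 N y (ξ - 1)) := by linarith
  have t1 := htaylor _ _ hx (by linarith [infD1_le_d1 hy' ξ, infD1_le_d1 hy' (ξ + 1)] :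
    2 * m ≤ 2 * d1 N y ξ + eps N * d2 N y ξ)
  have t2 := htaylor _ _ hx (by linarith [infD1_le_d1 hy' ξ, infD1_le_d1 hy' (ξ - 1)] :
    2 * m ≤ 2 * d1 N y ξ + -(eps N * d2 N y (ξ - 1)))
  have hα2 : 2 * α ξ - (1 - β ξ) - (1 - β (ξ - 1)) = -(α (ξ + 1) - 2 * α ξ + α (ξ - 1)) := by
    simp only [hα, hβ, sub_add_cancel, add_sub_cancel_right]
    ring
  have hC2 := hCle 2 (by norm_num) _ hx
  have hC3 := hCle 3 (by norm_num) _ hx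
  have hC4 := (abs_nonneg _).trans (hCle 4 le_rfl _ hx)
  have u1 := hS1 ξ
  have u2 := hS2 ξ
  have u3 := hS3 ξ
  have u4 := (le_abs_self _).trans (hS4 ξ)
  have u5 := (le_abs_self _).trans (hS4 (ξ - 1))
  simp only [AbarCoef, Acoef, a1, a2] at u1 u2 u3 u4 u5 ⊢
  set M1 := supAbs fun ξ => α (ξ + 1) - 2 * α ξ + α (ξ - 1)
  set M2 := supAbs fun ξ => (β ξ - β (ξ - 1)) * d2 N y ξ
  set M3 := supAbs fun ξ => (1 - β (ξ - 1)) * d3 N y ξ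
  set M4 := supAbs fun ξ => (1 - β ξ) * (d2 N y ξ) ^ 2
  set D0 := iteratedDeriv 2 φ (2 * d1 N y ξ)
  set D1 := iteratedDeriv 3 φ (2 * d1 N y ξ)
  set R1 := iteratedDeriv 2 φ (2 * d1 N y ξ + eps N * d2 N y ξ) - D0 - D1 * (eps N * d2 N y ξ)
    with hR1
  set R2 := iteratedDeriv 2 φ (2 * d1 N y ξ + -(eps N * d2 N y (ξ - 1))) - D0
    - D1 * -(eps N * d2 N y (ξ - 1)) with hR2
  have hsplit : ∀ P : ℝ,
      P + 2 * β ξ * iteratedDeriv 2 φ (2 * d1 N y ξ + eps N * d2 N y ξ)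
        + 2 * β (ξ - 1) * iteratedDeriv 2 φ (2 * d1 N y ξ + -(eps N * d2 N y (ξ - 1)))
        + 4 * α ξ * D0
        - (P + 2 * iteratedDeriv 2 φ (2 * d1 N y ξ + eps N * d2 N y ξ)
          + 2 * iteratedDeriv 2 φ (2 * d1 N y ξ + -(eps N * d2 N y (ξ - 1))))
      = -(2 * (D0 * (α (ξ + 1) - 2 * α ξ + α (ξ - 1))))
        + 2 * eps N * (D1 * ((β ξ - β (ξ - 1)) * d2 N y ξ))
        - 2 * eps N ^ 2 * (D1 * ((1 - β (ξ - 1)) * d3 N y ξ))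
        - 2 * ((1 - β ξ) * R1) - 2 * ((1 - β (ξ - 1)) * R2) := by
    intro P
    rw [hR1, hR2]
    linear_combination 2 * D0 * hα2 + 2 * eps N * D1 * (1 - β (ξ - 1)) * e3
  rw [hsplit]
  have b1 : |D0 * (α (ξ + 1) - 2 * α ξ + α (ξ - 1))| ≤ Cbound φ 2 (2 * m) * M1 := by
    rw [abs_mul]; gcongr; exact (abs_nonneg _).trans hC2
  have b2 : |D1 * ((β ξ - β (ξ - 1)) * d2 N y ξ)| ≤ Cbound φ 3 (2 * m) * M2 := by
    rw [abs_mul]; gcongr; exact (abs_nonneg _).trans hC3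
  have b3 : |D1 * ((1 - β (ξ - 1)) * d3 N y ξ)| ≤ Cbound φ 3 (2 * m) * M3 := by
    rw [abs_mul]; gcongr; exact (abs_nonneg _).trans hC3
  have b4 : |(1 - β ξ) * R1| ≤ eps N ^ 2 * (Cbound φ 4 (2 * m) * M4) / 2 := by
    rw [abs_mul, abs_of_nonneg (hβ1 ξ)]
    calc _ ≤ (1 - β ξ) * (Cbound φ 4 (2 * m) * (eps N * d2 N y ξ) ^ 2 / 2) :=
          mul_le_mul_of_nonneg_left t1 (hβ1 ξ)
      _ = eps N ^ 2 * (Cbound φ 4 (2 * m) * ((1 - β ξ) * d2 N y ξ ^ 2)) / 2 := by ring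
      _ ≤ _ := by gcongr
  have b5 : |(1 - β (ξ - 1)) * R2| ≤ eps N ^ 2 * (Cbound φ 4 (2 * m) * M4) / 2 := by
    rw [abs_mul, abs_of_nonneg (hβ1 (ξ - 1))]
    calc _ ≤ (1 - β (ξ - 1)) * (Cbound φ 4 (2 * m) * (-(eps N * d2 N y (ξ - 1))) ^ 2 / 2) :=
          mul_le_mul_of_nonneg_left t2 (hβ1 (ξ - 1))
      _ = eps N ^ 2 * (Cbound φ 4 (2 * m) * ((1 - β (ξ - 1)) * d2 N y (ξ - 1) ^ 2)) / 2 := by ring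
      _ ≤ _ := by gcongr
  have hε1 : 0 ≤ 2 * eps N := by positivity
  have hε2 : 0 ≤ 2 * eps N ^ 2 := by positivity
  rw [abs_le] at b1 b2 b3 b4 b5 ⊢
  have p1 := mul_le_mul_of_nonneg_left b2.1 hε1
  have p2 := mul_le_mul_of_nonneg_left b2.2 hε1
  have q1 := mul_le_mul_of_nonneg_left b3.1 hε2
  have q2 := mul_le_mul_of_nonneg_left b3.2 hε2
  constructor <;> linarith
end

section
/- (A priori stability of BQCE.) Let γ : ℤ → [0,1] be N-periodic with α_ξ := (γ_ξ + γ_{ξ−1})/2 and β_ξ := 1 − (γ_{ξ+1} + γ_{ξ−1})/2, let y ∈ 𝒴 with min_ξ y'_ξ ≥ r*/2 > 0, set A̲ := min_ξ A_ξ and C̄_i := C_i(2 min_ξ y'_ξ). Then c_γ(y) ≥ A̲ − 2C̄₂ max_ξ |Δ²α_ξ| − 2εC̄₃ max_ξ |Δβ_ξ · y''_ξ| − 2ε² ( C̄₃ max_ξ |(1−β_{ξ−1}) y'''_ξ| + C̄₄ max_ξ |(1−β_ξ)(y''_ξ)²| ). -/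
open scoped BigOperators ENNReal
open Finset

/-! ### Periodic sequences -/

theorem sum_Icc_one_eq_sum_range (f : ℤ → ℝ) (N : ℕ) :
    ∑ ξ ∈ Finset.Icc (1 : ℤ) N, f ξ = ∑ i ∈ Finset.range N, f (i + 1) := by
  refine (Finset.sum_bij (fun (i : ℕ) _ => (i : ℤ) + 1) ?_ ?_ ?_ fun _ _ => rfl).symm
  · intro i hi
    simp only [Finset.mem_range, Finset.mem_Icc] at *
    lia
  · intro i _ j _ h
    lia
  · intro ξ hξ
    simp only [Finset.mem_range, Finset.mem_Icc] at *
    exact ⟨(ξ - 1).toNat, by lia, by lia⟩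

namespace IsPeriodic

variable {N : ℕ} {v : ℤ → ℝ}

theorem finite_range (hN : 0 < N) (h : IsPeriodic N v) : (Set.range v).Finite := by
  refine ((Set.finite_Ico (0 : ℤ) N).image v).subset ?_
  rintro _ ⟨ξ, rfl⟩
  have hN' : (0 : ℤ) < N := by exact_mod_cast hN
  obtain ⟨ζ, hζ, h'⟩ := Function.Periodic.exists_mem_Ico₀ (f := v) (c := (N : ℤ)) h hN' ξ
  exact ⟨ζ, hζ, h'.symm⟩

theorem sum_shift (h : IsPeriodic N v) :
    ∑ ξ ∈ Finset.Icc (1 : ℤ) N, v (ξ + 1) = ∑ ξ ∈ Finset.Icc (1 : ℤ) N, v ξ := by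
  rw [sum_Icc_one_eq_sum_range, sum_Icc_one_eq_sum_range, ← sub_eq_zero, ← Finset.sum_sub_distrib]
  have := Finset.sum_range_sub (fun i : ℕ => v (i + 1)) N
  push_cast at this
  rw [this, add_comm (N : ℤ), h 1, sub_self]

theorem abs_le_supAbs_s12 (hN : 0 < N) (h : IsPeriodic N v) (ξ : ℤ) : |v ξ| ≤ supAbs v := by
  have hp : IsPeriodic N fun ξ => |v ξ| := fun ξ => by simp only [h ξ]
  exact le_csSup (hp.finite_range hN).bddAbove ⟨ξ, rfl⟩

theorem d1 (h : IsPeriodic N v) : IsPeriodic N (d1 N v) := fun ξ => by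
  simp only [_root_.d1]
  rw [add_sub_right_comm, h, h]

end IsPeriodic

theorem eps_pos {N : ℕ} (hN : 0 < N) : 0 < eps N := by
  unfold eps
  positivity

theorem d1_add_mul (N : ℕ) (y u : ℤ → ℝ) (t : ℝ) (ξ : ℤ) :
    d1 N (fun ξ => y ξ + t * u ξ) ξ = d1 N y ξ + t * d1 N u ξ := by
  simp only [d1]
  ring

theorem inY.isPeriodic_d1 {N : ℕ} {y : ℤ → ℝ} (hy : inY N y) :
    IsPeriodic N (d1 N y) := by
  obtain ⟨F, -, u, ⟨hu, -⟩, rfl⟩ := hy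
  intro ξ
  simp only [d1, yUnif]
  rw [add_sub_right_comm ξ, hu, hu]
  push_cast
  ring

theorem d2_eq (N : ℕ) (y : ℤ → ℝ) (ξ : ℤ) :
    d2 N y ξ = (d1 N y (ξ + 1) - d1 N y ξ) / eps N := by
  simp only [d1, d2, add_sub_cancel_right]
  ring

theorem d3_eq (N : ℕ) (y : ℤ → ℝ) (ξ : ℤ) :
    d3 N y ξ = (d1 N y (ξ + 1) - 2 * d1 N y ξ + d1 N y (ξ - 1)) / eps N ^ 2 := by
  simp only [d1, d3, add_sub_cancel_right]
  rw [show ξ - 1 - 1 = ξ - 2 by ring]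
  ring

theorem infD1_le {N : ℕ} {y : ℤ → ℝ} (hN : 0 < N) (hy : inY N y) (ξ : ℤ) :
    infD1 N y ≤ d1 N y ξ :=
  csInf_le (hy.isPeriodic_d1.finite_range hN).bddBelow ⟨ξ, rfl⟩

/-! ### The normalization constraint -/

theorem sum_sq_of_lpnorm_two_eq_one {N : ℕ} {v : ℤ → ℝ} (h : lpnorm N 2 v = 1) :
    eps N * ∑ ξ ∈ Finset.Icc (1 : ℤ) N, v ξ ^ 2 = 1 := by
  have h' : √(eps N * ∑ ξ ∈ Finset.Icc (1 : ℤ) N, v ξ ^ 2) = 1 := by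
    simpa [lpnorm, Real.sqrt_eq_rpow] using h
  exact Real.sqrt_eq_one.1 h'

theorem lpnorm_two_eq_one {N : ℕ} {v : ℤ → ℝ}
    (h : eps N * ∑ ξ ∈ Finset.Icc (1 : ℤ) N, v ξ ^ 2 = 1) : lpnorm N 2 v = 1 := by
  simp [lpnorm, h]

theorem exists_inU_lpnorm_d1_eq_one {N : ℕ} (hN : 2 ≤ N) :
    ∃ u : ℤ → ℝ, inU N u ∧ lpnorm N 2 (d1 N u) = 1 := by
  classical
  have hN0 : 0 < N := by lia
  have hε := eps_pos hN0
  set w : ℤ → ℝ := fun ξ => (if (N : ℤ) ∣ ξ then 1 else 0) - eps N with hw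
  have hwper : IsPeriodic N w := fun ξ => by simp [hw]
  have hwsum : ∑ ξ ∈ Finset.Icc (1 : ℤ) N, w ξ = 0 := by
    have hfilter : {ξ ∈ Finset.Icc (1 : ℤ) N | (N : ℤ) ∣ ξ} = {(N : ℤ)} := by
      ext ξ
      simp only [Finset.mem_filter, Finset.mem_Icc, Finset.mem_singleton]
      constructor
      · rintro ⟨⟨h1, h2⟩, h3⟩
        exact le_antisymm h2 (Int.le_of_dvd (by lia) h3)
      · rintro rfl
        exact ⟨⟨by lia, le_rfl⟩, dvd_rfl⟩
    simp only [hw, Finset.sum_sub_distrib, Finset.sum_boole, hfilter]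
    have : (N : ℝ) ≠ 0 := by positivity
    simp [eps, this]
  set S := eps N * ∑ ξ ∈ Finset.Icc (1 : ℤ) N, d1 N w ξ ^ 2 with hS
  have hSpos : 0 < S := by
    refine mul_pos hε (Finset.sum_pos' (fun _ _ => sq_nonneg _) ⟨N, ?_, ?_⟩)
    · simp only [Finset.mem_Icc]
      lia
    · have h1 : ¬ (N : ℤ) ∣ N - 1 := by
        intro h
        have := Int.le_of_dvd (by lia) h
        lia
      have : d1 N w N = 1 / eps N := by simp [d1, hw, h1]
      rw [this]
      positivity
  have hd : ∀ ξ, d1 N (fun ξ => (√S)⁻¹ * w ξ) ξ = (√S)⁻¹ * d1 N w ξ := fun ξ => by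
    simp only [d1]
    ring
  refine ⟨fun ξ => (√S)⁻¹ * w ξ, ⟨fun ξ => by simp only [hwper ξ], ?_⟩, lpnorm_two_eq_one ?_⟩
  · rw [← Finset.mul_sum, hwsum, mul_zero]
  · simp only [hd, mul_pow, ← Finset.mul_sum, inv_pow, Real.sq_sqrt hSpos.le]
    rw [mul_left_comm, ← hS, inv_mul_cancel₀ (ne_of_gt hSpos)]

/-! ### Calculus for the interaction potential -/

section Potential

variable {φ : ℝ → ℝ}

theorem hasDerivAt_iteratedDeriv_of_contDiffOn_Ioi {m n : ℕ} (hφ : ContDiffOn ℝ n φ (Set.Ioi 0))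
    (hm : m < n) {r : ℝ} (hr : 0 < r) :
    HasDerivAt (iteratedDeriv m φ) (iteratedDeriv (m + 1) φ r) r := by
  have hd := hφ.differentiableOn_iteratedDerivWithin (m := m) (by exact_mod_cast hm)
    isOpen_Ioi.uniqueDiffOn
  have hd' : DifferentiableOn ℝ (iteratedDeriv m φ) (Set.Ioi 0) :=
    hd.congr fun x hx => (iteratedDerivWithin_of_isOpen isOpen_Ioi hx).symm
  rw [iteratedDeriv_succ]
  exact (hd'.differentiableAt (Ioi_mem_nhds hr)).hasDerivAt

theorem iteratedDeriv_two_comp_affine {c : ℝ} (d : ℝ) (hφ : ContDiffAt ℝ 2 φ c) :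
    ContDiffAt ℝ 2 (fun t => φ (c + t * d)) 0 ∧
      iteratedDeriv 2 (fun t => φ (c + t * d)) 0 = iteratedDeriv 2 φ c * d ^ 2 := by
  have hf : ContDiff ℝ 2 fun t : ℝ => c + t * d := by fun_prop
  have hc : ContDiffAt ℝ 2 φ (c + 0 * d) := by simpa using hφ
  have hd : deriv (fun t : ℝ => c + t * d) = fun _ => d := by
    ext t
    simp
  refine ⟨ContDiffAt.comp (g := φ) 0 hc hf.contDiffAt, ?_⟩
  have := iteratedDeriv_comp_two (g := φ) (f := fun t : ℝ => c + t * d) (x := 0) hc hf.contDiffAt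
  simpa [Function.comp_def, iteratedDeriv_succ, hd] using this

theorem abs_sub_sub_mul_le_of_abs_deriv_two_le {f f' f'' : ℝ → ℝ} {s : Set ℝ} (hs : Convex ℝ s)
    (hf : ∀ x ∈ s, HasDerivAt f (f' x) x) (hf' : ∀ x ∈ s, HasDerivAt f' (f'' x) x) {C : ℝ}
    (hC : ∀ x ∈ s, |f'' x| ≤ C) {x a : ℝ} (hx : x ∈ s) (hxa : x + a ∈ s) :
    |f (x + a) - f x - f' x * a| ≤ C / 2 * a ^ 2 := by
  have hmem : ∀ t ∈ Set.Icc (0 : ℝ) 1, x + t * a ∈ s := fun t ht => by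
    simpa using hs.add_smul_mem hx hxa ht
  have hline : ∀ t : ℝ, HasDerivAt (fun t => x + t * a) a t := fun t => by
    simpa using ((hasDerivAt_id t).mul_const a).const_add x
  have hderiv : ∀ t ∈ Set.Icc (0 : ℝ) 1, HasDerivAt
      (fun t => f (x + t * a) - f x - f' x * (t * a)) (f' (x + t * a) * a - f' x * a) t := by
    intro t ht
    have h1 := (hf _ (hmem t ht)).comp t (hline t)
    have h2 := ((hasDerivAt_id t).mul_const a).const_mul (f' x)
    simpa using (h1.sub_const (f x)).fun_sub h2
  have hB : ∀ t : ℝ, HasDerivAt (fun t => C / 2 * a ^ 2 * t ^ 2) (C * a ^ 2 * t) t := fun t => by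
    have := (hasDerivAt_pow 2 t).const_mul (C / 2 * a ^ 2)
    exact this.congr_deriv (by push_cast; ring)
  have key := image_norm_le_of_norm_deriv_right_le_deriv_boundary (a := 0) (b := 1)
    (fun t ht => (hderiv t ht).continuousAt.continuousWithinAt)
    (fun t ht => (hderiv t ⟨ht.1, ht.2.le⟩).hasDerivWithinAt) (by simp) hB
    (fun t ht => by
      have := hs.norm_image_sub_le_of_norm_hasDerivWithin_le
        (fun z hz => (hf' z hz).hasDerivWithinAt) hC hx (hmem t ⟨ht.1, ht.2.le⟩)
      rw [← sub_mul, norm_mul]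
      calc ‖f' (x + t * a) - f' x‖ * ‖a‖ ≤ C * ‖x + t * a - x‖ * ‖a‖ := by gcongr
        _ = C * a ^ 2 * t := by
          rw [add_sub_cancel_left, norm_mul, Real.norm_of_nonneg ht.1, ← sq_abs a,
            Real.norm_eq_abs]
          ring)
    (Set.right_mem_Icc.2 zero_le_one)
  simpa using key

theorem abs_iteratedDeriv_le_Cbound {i : ℕ} {r₀ r : ℝ}
    (hC : BddAbove ((fun r => |iteratedDeriv i φ r|) '' Set.Ici r₀)) (hr : r₀ ≤ r) :
    |iteratedDeriv i φ r| ≤ Cbound φ i r₀ :=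
  le_csSup hC ⟨r, hr, rfl⟩

theorem iteratedDeriv_two_nonpos_of_le {rstar r : ℝ} (hφ : ContDiffOn ℝ 4 φ (Set.Ioi 0))
    (hrstar : 0 < rstar) (hconcave : ∀ r : ℝ, rstar < r → iteratedDeriv 2 φ r < 0)
    (hr : rstar ≤ r) : iteratedDeriv 2 φ r ≤ 0 := by
  have hcont : ContinuousAt (iteratedDeriv 2 φ) r :=
    (hasDerivAt_iteratedDeriv_of_contDiffOn_Ioi (m := 2) (n := 4) hφ (by norm_num)
      (hrstar.trans_le hr)).continuousAt
  refine le_of_tendsto (hcont.tendsto.mono_left (nhdsWithin_le_nhds (s := Set.Ioi r))) ?_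
  filter_upwards [self_mem_nhdsWithin] with x hx
  exact (hconcave x (hr.trans_lt hx)).le

/-- The second variation of the BQC energy. -/
theorem svar_PhiBQC {N : ℕ} (hφ : ContDiffOn ℝ 2 φ (Set.Ioi 0)) (α β : ℤ → ℝ) {y : ℤ → ℝ}
    (hy : ∀ ξ, 0 < d1 N y ξ) (u : ℤ → ℝ) :
    svar (PhiBQC N φ α β) y u = eps N * ∑ ξ ∈ Finset.Icc (1 : ℤ) N,
      (iteratedDeriv 2 φ (d1 N y ξ) * d1 N u ξ ^ 2
        + α ξ * (iteratedDeriv 2 φ (2 * d1 N y ξ) * (2 * d1 N u ξ) ^ 2)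
        + β ξ * (iteratedDeriv 2 φ (d1 N y ξ + d1 N y (ξ + 1))
          * (d1 N u ξ + d1 N u (ξ + 1)) ^ 2)) := by
  have hφat : ∀ {r : ℝ}, 0 < r → ContDiffAt ℝ 2 φ r := fun hr => hφ.contDiffAt (Ioi_mem_nhds hr)
  have hline : (fun t : ℝ => PhiBQC N φ α β fun ξ => y ξ + t * u ξ) =
      fun t => eps N * ∑ ξ ∈ Finset.Icc (1 : ℤ) N,
        (φ (d1 N y ξ + t * d1 N u ξ) + α ξ * φ (2 * d1 N y ξ + t * (2 * d1 N u ξ))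
          + β ξ * φ (d1 N y ξ + d1 N y (ξ + 1) + t * (d1 N u ξ + d1 N u (ξ + 1)))) := by
    ext t
    simp only [PhiBQC, d1_add_mul]
    refine congrArg _ (Finset.sum_congr rfl fun ξ _ => ?_)
    rw [show 2 * (d1 N y ξ + t * d1 N u ξ) = 2 * d1 N y ξ + t * (2 * d1 N u ξ) by ring,
      show d1 N y ξ + t * d1 N u ξ + (d1 N y (ξ + 1) + t * d1 N u (ξ + 1))
        = d1 N y ξ + d1 N y (ξ + 1) + t * (d1 N u ξ + d1 N u (ξ + 1)) by ring]
  have h1 := fun ξ => iteratedDeriv_two_comp_affine (d1 N u ξ) (hφat (hy ξ))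
  have h2 := fun ξ => iteratedDeriv_two_comp_affine (2 * d1 N u ξ)
    (hφat (mul_pos two_pos (hy ξ)))
  have h3 := fun ξ => iteratedDeriv_two_comp_affine (d1 N u ξ + d1 N u (ξ + 1))
    (hφat (add_pos (hy ξ) (hy (ξ + 1))))
  have h2' := fun ξ => contDiffAt_const (c := α ξ).mul (h2 ξ).1
  have h3' := fun ξ => contDiffAt_const (c := β ξ).mul (h3 ξ).1
  rw [svar, hline, iteratedDeriv_const_mul_field,
    iteratedDeriv_fun_sum fun ξ _ => ((h1 ξ).1.add (h2' ξ)).add (h3' ξ)]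
  congr 1
  refine Finset.sum_congr rfl fun ξ _ => ?_
  rw [iteratedDeriv_fun_add ((h1 ξ).1.add (h2' ξ)) (h3' ξ), iteratedDeriv_fun_add (h1 ξ).1 (h2' ξ),
    iteratedDeriv_const_mul_field, iteratedDeriv_const_mul_field, (h1 ξ).2, (h2 ξ).2, (h3 ξ).2]

end Potential

/-- When next-nearest neighbour bonds are in the concave region, the second variation of the BQC
energy is bounded below by the diagonal form with coefficients `AbarCoef`. -/
theorem sum_AbarCoef_le_svar_PhiBQC {N : ℕ} {φ : ℝ → ℝ} (hφ : ContDiffOn ℝ 2 φ (Set.Ioi 0))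
    {α β y u : ℤ → ℝ} (hβper : IsPeriodic N β) (hβ0 : ∀ ξ, 0 ≤ β ξ)
    (hyper : IsPeriodic N (d1 N y)) (hy : ∀ ξ, 0 < d1 N y ξ)
    (hneg : ∀ ξ, iteratedDeriv 2 φ (d1 N y ξ + d1 N y (ξ + 1)) ≤ 0) (hu : IsPeriodic N u) :
    eps N * ∑ ξ ∈ Finset.Icc (1 : ℤ) N, AbarCoef N φ α β y ξ * d1 N u ξ ^ 2
      ≤ svar (PhiBQC N φ α β) y u := by
  rw [svar_PhiBQC hφ α β hy u]
  refine mul_le_mul_of_nonneg_left ?_ (by unfold eps; positivity)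
  set g : ℤ → ℝ := fun ξ => 2 * β (ξ - 1) * iteratedDeriv 2 φ (d1 N y (ξ - 1) + d1 N y ξ)
    * d1 N u ξ ^ 2 with hg
  have hgper : IsPeriodic N g := fun ξ => by
    simp only [hg]
    rw [add_sub_right_comm, hβper, hyper, hyper, hu.d1]
  have hsplit : ∀ ξ, AbarCoef N φ α β y ξ * d1 N u ξ ^ 2
      = (AbarCoef N φ α β y ξ * d1 N u ξ ^ 2 - g ξ) + g ξ := fun ξ => by ring
  rw [Finset.sum_congr rfl fun ξ _ => hsplit ξ, Finset.sum_add_distrib, ← hgper.sum_shift,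
    ← Finset.sum_add_distrib]
  refine Finset.sum_le_sum fun ξ _ => ?_
  have hle := mul_nonneg (hβ0 ξ) (mul_nonneg (neg_nonneg.2 (hneg ξ))
    (sq_nonneg (d1 N u ξ - d1 N u (ξ + 1))))
  simp only [hg, AbarCoef, add_sub_cancel_right]
  linarith

/-- Elementary estimate of the blended second difference of `f` at `x`. -/
theorem abs_blend_sub_le {f : ℝ → ℝ} {x a b p q D C₃ C₄ M₁ M₂ M₃ : ℝ} (hp : 0 ≤ p) (hq : 0 ≤ q)
    (hD : |D| ≤ C₃) (hC₄ : 0 ≤ C₄)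
    (ha : |f (x + a) - f x - D * a| ≤ C₄ / 2 * a ^ 2)
    (hb : |f (x - b) - f x - D * -b| ≤ C₄ / 2 * (-b) ^ 2)
    (h₁ : |(p - q) * a| ≤ M₁) (h₂ : |q * (a - b)| ≤ M₂) (hpa : p * a ^ 2 ≤ M₃)
    (hqb : q * b ^ 2 ≤ M₃) :
    p * (f (x + a) - f x) + q * (f (x - b) - f x) ≤ C₃ * M₁ + C₃ * M₂ + C₄ * M₃ := by
  have hC₃ : 0 ≤ C₃ := (abs_nonneg D).trans hD
  have e₁ : D * ((p - q) * a) ≤ C₃ * M₁ :=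
    (le_abs_self _).trans ((abs_mul _ _).trans_le (mul_le_mul hD h₁ (abs_nonneg _) hC₃))
  have e₂ : D * (q * (a - b)) ≤ C₃ * M₂ :=
    (le_abs_self _).trans ((abs_mul _ _).trans_le (mul_le_mul hD h₂ (abs_nonneg _) hC₃))
  have e₃ := mul_le_mul_of_nonneg_left ((le_abs_self _).trans ha) hp
  have e₄ := mul_le_mul_of_nonneg_left ((le_abs_self _).trans hb) hq
  have e₅ := mul_le_mul_of_nonneg_left hpa hC₄
  have e₆ := mul_le_mul_of_nonneg_left hqb hC₄
  linarith

/-- A priori stability of BQCE. -/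
theorem apriori_stability_bqce
    (N : ℕ) (hN : 5 ≤ N) (φ : ℝ → ℝ) (hφ : ContDiffOn ℝ 4 φ (Set.Ioi 0))
    (hC : ∀ i ≤ 4, ∀ r₀ : ℝ, 0 < r₀ →
      BddAbove ((fun r => |iteratedDeriv i φ r|) '' Set.Ici r₀))
    (rstar : ℝ) (hrstar : 0 < rstar)
    (hconvex : ∀ r : ℝ, 0 < r → r < rstar → 0 < iteratedDeriv 2 φ r)
    (hconcave : ∀ r : ℝ, rstar < r → iteratedDeriv 2 φ r < 0)
    (γ : ℤ → ℝ) (hγper : IsPeriodic N γ) (hγ01 : ∀ ξ, γ ξ ∈ Set.Icc (0 : ℝ) 1)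
    (α β : ℤ → ℝ) (hα : α = fun ξ => (γ ξ + γ (ξ - 1)) / 2)
    (hβ : β = fun ξ => 1 - (γ (ξ + 1) + γ (ξ - 1)) / 2)
    (y : ℤ → ℝ) (hy : inY N y) (hy' : rstar / 2 ≤ infD1 N y) :
    sInf (Set.range fun ξ => Acoef N φ y ξ)
        - 2 * Cbound φ 2 (2 * infD1 N y) * supAbs (fun ξ => α (ξ + 1) - 2 * α ξ + α (ξ - 1))
        - 2 * eps N * Cbound φ 3 (2 * infD1 N y) *
            supAbs (fun ξ => (β ξ - β (ξ - 1)) * d2 N y ξ)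
        - 2 * (eps N) ^ 2 *
            (Cbound φ 3 (2 * infD1 N y) * supAbs (fun ξ => (1 - β (ξ - 1)) * d3 N y ξ)
              + Cbound φ 4 (2 * infD1 N y) *
                  supAbs (fun ξ => (1 - β ξ) * (d2 N y ξ) ^ 2))
      ≤ coercConst N (PhiBQCE N φ γ) y := by
  have hN0 : 0 < N := by lia
  have hε := eps_pos hN0
  set m := infD1 N y
  have hm0 : 0 < m := by linarith
  have hym : ∀ ξ, m ≤ d1 N y ξ := infD1_le hN0 hy
  have hyper := hy.isPeriodic_d1
  have hβper : IsPeriodic N β := fun ξ => by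
    simp only [hβ]
    rw [add_right_comm, add_sub_right_comm, hγper, hγper]
  have hαper : IsPeriodic N α := fun ξ => by
    simp only [hα]
    rw [add_sub_right_comm, hγper, hγper]
  have hβ0 : ∀ ξ, 0 ≤ β ξ := fun ξ => by
    simp only [hβ]
    linarith [(hγ01 (ξ + 1)).2, (hγ01 (ξ - 1)).2]
  have hβ1 : ∀ ξ, 0 ≤ 1 - β ξ := fun ξ => by
    simp only [hβ]
    linarith [(hγ01 (ξ + 1)).1, (hγ01 (ξ - 1)).1]
  have hd2per : IsPeriodic N (d2 N y) := fun ξ => by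
    simp only [d2_eq]
    rw [add_right_comm, hyper, hyper]
  have hd3per : IsPeriodic N (d3 N y) := fun ξ => by
    simp only [d3_eq]
    rw [add_right_comm, add_sub_right_comm, hyper, hyper, hyper]
  have hAper : IsPeriodic N (Acoef N φ y) := fun ξ => by
    simp only [Acoef]
    rw [add_right_comm ξ, add_sub_right_comm, hyper, hyper, hyper]
  set S₁ := supAbs fun ξ => α (ξ + 1) - 2 * α ξ + α (ξ - 1) with hS₁
  set S₂ := supAbs fun ξ => (β ξ - β (ξ - 1)) * d2 N y ξ with hS₂
  set S₃ := supAbs fun ξ => (1 - β (ξ - 1)) * d3 N y ξ with hS₃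
  set S₄ := supAbs fun ξ => (1 - β ξ) * d2 N y ξ ^ 2 with hS₄
  have b₁ : ∀ ξ, |α (ξ + 1) - 2 * α ξ + α (ξ - 1)| ≤ S₁ := IsPeriodic.abs_le_supAbs_s12 hN0
    fun ξ => by rw [add_right_comm, add_sub_right_comm, hαper, hαper, hαper]
  have b₂ : ∀ ξ, |(β ξ - β (ξ - 1)) * d2 N y ξ| ≤ S₂ := IsPeriodic.abs_le_supAbs_s12 hN0
    fun ξ => by rw [add_sub_right_comm, hβper, hβper, hd2per]
  have b₃ : ∀ ξ, |(1 - β (ξ - 1)) * d3 N y ξ| ≤ S₃ := IsPeriodic.abs_le_supAbs_s12 hN0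
    fun ξ => by rw [add_sub_right_comm, hβper, hd3per]
  have b₄ : ∀ ξ, |(1 - β ξ) * d2 N y ξ ^ 2| ≤ S₄ := IsPeriodic.abs_le_supAbs_s12 hN0
    fun ξ => by rw [hβper, hd2per]
  have h2m : 0 < 2 * m := by linarith
  have hbound : ∀ i ≤ 4, ∀ r, 2 * m ≤ r → |iteratedDeriv i φ r| ≤ Cbound φ i (2 * m) :=
    fun i hi r hr => abs_iteratedDeriv_le_Cbound (hC i hi _ h2m) hr
  set C₂ := Cbound φ 2 (2 * m) with hC₂
  set C₃ := Cbound φ 3 (2 * m) with hC₃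
  set C₄ := Cbound φ 4 (2 * m) with hC₄
  have hC₄0 : 0 ≤ C₄ := (abs_nonneg _).trans (hbound 4 le_rfl _ le_rfl)
  have htaylor : ∀ {x a : ℝ}, 2 * m ≤ x → 2 * m ≤ x + a →
      |iteratedDeriv 2 φ (x + a) - iteratedDeriv 2 φ x - iteratedDeriv 3 φ x * a|
        ≤ C₄ / 2 * a ^ 2 := fun {x a} hx hxa =>
    abs_sub_sub_mul_le_of_abs_deriv_two_le (convex_Ici (2 * m))
      (fun z hz => hasDerivAt_iteratedDeriv_of_contDiffOn_Ioi (m := 2) (n := 4) hφ (by norm_num)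
        (h2m.trans_le hz))
      (fun z hz => hasDerivAt_iteratedDeriv_of_contDiffOn_Ioi (m := 3) (n := 4) hφ (by norm_num)
        (h2m.trans_le hz))
      (fun z hz => hbound 4 le_rfl z hz) hx hxa
  set E := sInf (Set.range fun ξ => Acoef N φ y ξ) - 2 * C₂ * S₁ - 2 * eps N * C₃ * S₂
    - 2 * eps N ^ 2 * (C₃ * S₃ + C₄ * S₄) with hE
  have hcoef : ∀ ξ, E ≤ AbarCoef N φ α β y ξ := by
    intro ξ
    have hA : sInf (Set.range fun ξ => Acoef N φ y ξ) ≤ Acoef N φ y ξ :=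
      csInf_le (hAper.finite_range hN0).bddBelow ⟨ξ, rfl⟩
    have ha : d1 N y (ξ + 1) - d1 N y ξ = eps N * d2 N y ξ := by
      rw [d2_eq]
      field_simp
    have hb : d1 N y ξ - d1 N y (ξ - 1) = eps N * d2 N y (ξ - 1) := by
      rw [d2_eq, sub_add_cancel]
      field_simp
    have hab : eps N * d2 N y ξ - eps N * d2 N y (ξ - 1) = eps N ^ 2 * d3 N y ξ := by
      rw [← ha, ← hb, d3_eq]
      field_simp
      ring
    have hxa : d1 N y ξ + d1 N y (ξ + 1) = 2 * d1 N y ξ + eps N * d2 N y ξ := by linarith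
    have hxb : d1 N y (ξ - 1) + d1 N y ξ = 2 * d1 N y ξ - eps N * d2 N y (ξ - 1) := by linarith
    have hx : 2 * m ≤ 2 * d1 N y ξ := by linarith [hym ξ]
    have hblend : 2 * α ξ = (1 - β ξ) + (1 - β (ξ - 1)) - (α (ξ + 1) - 2 * α ξ + α (ξ - 1)) := by
      simp only [hα, hβ, add_sub_cancel_right, sub_add_cancel]
      ring
    have hsecond : (α (ξ + 1) - 2 * α ξ + α (ξ - 1)) * iteratedDeriv 2 φ (2 * d1 N y ξ)
        ≤ S₁ * C₂ :=
      (le_abs_self _).trans ((abs_mul _ _).trans_le (mul_le_mul (b₁ ξ)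
        (hbound 2 (by norm_num) _ hx) (abs_nonneg _) ((abs_nonneg _).trans (b₁ ξ))))
    have hdiff := abs_blend_sub_le (f := iteratedDeriv 2 φ) (x := 2 * d1 N y ξ)
      (a := eps N * d2 N y ξ) (b := eps N * d2 N y (ξ - 1)) (C₃ := C₃) (M₁ := eps N * S₂)
      (M₂ := eps N ^ 2 * S₃) (M₃ := eps N ^ 2 * S₄) (hβ1 ξ) (hβ1 (ξ - 1))
      (hbound 3 (by norm_num) _ hx) hC₄0
      (htaylor hx (by linarith [hym ξ, hym (ξ + 1)]))
      (htaylor hx (by linarith [hym ξ, hym (ξ - 1)]))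
      (by
        rw [show (1 - β ξ - (1 - β (ξ - 1))) * (eps N * d2 N y ξ)
          = -(eps N * ((β ξ - β (ξ - 1)) * d2 N y ξ)) by ring, abs_neg, abs_mul, abs_of_pos hε]
        exact mul_le_mul_of_nonneg_left (b₂ ξ) hε.le)
      (by
        rw [hab, mul_left_comm, abs_mul, abs_of_pos (pow_pos hε 2)]
        exact mul_le_mul_of_nonneg_left (b₃ ξ) (by positivity))
      (by
        rw [mul_pow, mul_left_comm]
        exact mul_le_mul_of_nonneg_left ((le_abs_self _).trans (b₄ ξ)) (by positivity))
      (by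
        rw [mul_pow, mul_left_comm]
        exact mul_le_mul_of_nonneg_left ((le_abs_self _).trans (b₄ (ξ - 1))) (by positivity))
    have hα4 : 4 * α ξ * iteratedDeriv 2 φ (2 * d1 N y ξ) = 2 * ((1 - β ξ) + (1 - β (ξ - 1))
        - (α (ξ + 1) - 2 * α ξ + α (ξ - 1))) * iteratedDeriv 2 φ (2 * d1 N y ξ) := by
      rw [← hblend]
      ring
    have hgap : -(2 * C₂ * S₁ + 2 * eps N * C₃ * S₂ + 2 * eps N ^ 2 * (C₃ * S₃ + C₄ * S₄))
        ≤ AbarCoef N φ α β y ξ - Acoef N φ y ξ := by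
      simp only [Acoef, AbarCoef, hxa, hxb, hα4]
      linarith only [hsecond, hdiff]
    linarith only [hA, hgap, hE]
  obtain ⟨u₀, hu₀, hu₀1⟩ := exists_inU_lpnorm_d1_eq_one (N := N) (by lia)
  refine le_csInf ⟨_, u₀, hu₀, hu₀1, rfl⟩ ?_
  rintro _ ⟨u, ⟨hu, -⟩, hu1, rfl⟩
  have hsvar := sum_AbarCoef_le_svar_PhiBQC (α := α) (hφ.of_le (by norm_num)) hβper hβ0 hyper
    (fun ξ => hm0.trans_le (hym ξ))
    (fun ξ => iteratedDeriv_two_nonpos_of_le hφ hrstar hconcave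
      (by linarith [hym ξ, hym (ξ + 1)])) hu
  rw [PhiBQCE, ← hα, ← hβ]
  refine le_trans ?_ hsvar
  calc E = eps N * ∑ ξ ∈ Finset.Icc (1 : ℤ) N, E * d1 N u ξ ^ 2 := by
        rw [← Finset.mul_sum, mul_left_comm, sum_sq_of_lpnorm_two_eq_one hu1, mul_one]
    _ ≤ _ := mul_le_mul_of_nonneg_left
        (Finset.sum_le_sum fun ξ _ => mul_le_mul_of_nonneg_right (hcoef ξ) (sq_nonneg _)) hε.le
end
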